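/- arXiv:1301.1232 — 15 statements merged into one kernel-verified Lean document; each statement's English description precedes it below -/
import Mathlib

section
/- Let M be a monoid and θ : M → M a monoid homomorphism such that θ(s) is a unit of M for every s ∈ M. Then the ℤ-Bruck–Reilly extension B(M,ℤ,θ) is a simple semigroup: every two-sided ideal of B(M,ℤ,θ), i.e. every nonempty subset I with B(M,ℤ,θ)·I ⊆ I and I·B(M,ℤ,θ) ⊆ I, is equal to all of B(M,ℤ,θ). -/
/-- The multiplication of the ℤ-Bruck–Reilly extension `B(M, ℤ, θ)` on `ℤ × M × ℤ`. -/
def BRmul {M : Type*} [Monoid M] (θ : Monoid.End M) :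
    ℤ × M × ℤ → ℤ × M × ℤ → ℤ × M × ℤ :=
  fun x y =>
    if x.2.2 < y.1 then (x.1 - x.2.2 + y.1, (θ ^ (y.1 - x.2.2).toNat) x.2.1 * y.2.1, y.2.2)
    else if x.2.2 = y.1 then (x.1, x.2.1 * y.2.1, y.2.2)
    else (x.1, x.2.1 * (θ ^ (x.2.2 - y.1).toNat) y.2.1, y.2.2 - y.1 + x.2.2)

/-- The ℤ-Bruck–Reilly extension of a monoid `M` (with respect to a homomorphism
`θ : M → M` all of whose values are units) is a simple semigroup: every two-sided
ideal equals the whole semigroup. -/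
theorem BRmul_simple {M : Type*} [Monoid M] (θ : Monoid.End M)
    (hθ : ∀ s : M, IsUnit (θ s))
    (I : Set (ℤ × M × ℤ)) (hne : I.Nonempty)
    (hl : ∀ a x, x ∈ I → BRmul θ a x ∈ I)
    (hr : ∀ a x, x ∈ I → BRmul θ x a ∈ I) :
    I = Set.univ := by
  obtain ⟨⟨i, s, j⟩, hx⟩ := hne
  obtain ⟨u, hu⟩ := hθ s
  refine Set.eq_univ_of_forall ?_
  rintro ⟨p, t, q⟩
  have key : BRmul θ (BRmul θ (p, (↑u⁻¹ : M), i + 1) (i, s, j)) (j + 1, t, q) = (p, t, q) := by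
    have h : BRmul θ (p, (↑u⁻¹ : M), i + 1) (i, s, j) = (p, 1, j + 1) := by
      have hji : j - i + (i + 1) = j + 1 := by ring
      simp [BRmul, ← hu, hji]
    rw [h]
    simp [BRmul]
  rw [← key]
  exact hr _ _ (hl _ _ hx)
end

section
/- Let M be a monoid and θ : M → M a monoid homomorphism such that θ(s) is a unit of M for every s ∈ M. Then the ℤ-Bruck–Reilly extension B(M,ℤ,θ) is an inverse semigroup if and only if M is an inverse semigroup. -/
theorem BRmul_fst {M : Type*} [Monoid M] (θ : Monoid.End M) (x y : ℤ × M × ℤ) :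
    (BRmul θ x y).1 = x.1 - x.2.2 + max x.2.2 y.1 := by
  unfold BRmul
  split_ifs <;> dsimp only <;> omega

theorem BRmul_snd_snd {M : Type*} [Monoid M] (θ : Monoid.End M) (x y : ℤ × M × ℤ) :
    (BRmul θ x y).2.2 = y.2.2 - y.1 + max x.2.2 y.1 := by
  unfold BRmul
  split_ifs <;> dsimp only <;> omega

theorem BRmul_mk_mk {M : Type*} [Monoid M] (θ : Monoid.End M) (i j n : ℤ) (s t : M) :
    BRmul θ (i, s, j) (j, t, n) = (i, s * t, n) := by
  simp [BRmul]

theorem BRmul_inverse_pair_iff {M : Type*} [Monoid M] (θ : Monoid.End M)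
    (i j m n : ℤ) (s t : M) :
    (BRmul θ (BRmul θ (i, s, j) (m, t, n)) (i, s, j) = (i, s, j) ∧
        BRmul θ (BRmul θ (m, t, n) (i, s, j)) (m, t, n) = (m, t, n)) ↔
      m = j ∧ n = i ∧ s * t * s = s ∧ t * s * t = t := by
  constructor
  · intro h
    obtain ⟨rfl, rfl⟩ : m = j ∧ n = i := by
      have h₁ := congrArg Prod.fst h.1
      have h₂ := congrArg (fun z => z.2.2) h.1
      have h₃ := congrArg Prod.fst h.2
      have h₄ := congrArg (fun z => z.2.2) h.2
      simp only [BRmul_fst, BRmul_snd_snd] at h₁ h₂ h₃ h₄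
      omega
    simpa [BRmul_mk_mk] using h
  · rintro ⟨rfl, rfl, h⟩
    simpa [BRmul_mk_mk] using h

/-- The ℤ-Bruck–Reilly extension `B(M, ℤ, θ)` is an inverse semigroup (every element
has a unique inverse) if and only if the monoid `M` is an inverse semigroup. -/
theorem BRmul_inverse_iff {M : Type*} [Monoid M] (θ : Monoid.End M)
    (hθ : ∀ s : M, IsUnit (θ s)) :
    (∀ x : ℤ × M × ℤ, ∃! y : ℤ × M × ℤ,
        BRmul θ (BRmul θ x y) x = x ∧ BRmul θ (BRmul θ y x) y = y) ↔
      (∀ s : M, ∃! u : M, s * u * s = s ∧ u * s * u = u) := by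
  constructor
  · intro h s
    obtain ⟨⟨m, u, n⟩, hu, huniq⟩ := h (0, s, 0)
    refine ⟨u, ((BRmul_inverse_pair_iff θ 0 0 m n s u).1 hu).2.2, fun v hv => ?_⟩
    exact congrArg (fun z => z.2.1)
      (huniq (0, v, 0) ((BRmul_inverse_pair_iff θ 0 0 0 0 s v).2 ⟨rfl, rfl, hv⟩))
  · rintro h ⟨i, s, j⟩
    obtain ⟨u, hu, huniq⟩ := h s
    refine ⟨(j, u, i), (BRmul_inverse_pair_iff θ i j j i s u).2 ⟨rfl, rfl, hu⟩, ?_⟩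
    rintro ⟨m, v, n⟩ hv
    obtain ⟨rfl, rfl, hsv⟩ := (BRmul_inverse_pair_iff θ i j m n s v).1 hv
    rw [huniq v hsv]
end

section
/- Let M be a monoid and θ : M → M a monoid homomorphism such that θ(s) is a unit of M for every s ∈ M. Then the ℤ-Bruck–Reilly extension B(M,ℤ,θ) is a regular semigroup if and only if M is a regular semigroup. -/
/-- The ℤ-Bruck–Reilly extension `B(M, ℤ, θ)` is a regular semigroup if and only if
the monoid `M` is a regular semigroup. -/
theorem BRmul_regular_iff {M : Type*} [Monoid M] (θ : Monoid.End M)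
    (hθ : ∀ s : M, IsUnit (θ s)) :
    (∀ x : ℤ × M × ℤ, ∃ y : ℤ × M × ℤ, BRmul θ (BRmul θ x y) x = x) ↔
      (∀ s : M, ∃ u : M, s * u * s = s) := by
  refine ⟨fun h s => ?_, fun h => ?_⟩
  · obtain ⟨⟨m, t, n⟩, hy⟩ := h (0, s, 0)
    unfold BRmul at hy
    rcases lt_trichotomy 0 m with hm | hm | hm
    · simp only [hm, if_true] at hy
      split_ifs at hy <;> simp only [Prod.mk.injEq] at hy <;> omega
    · subst hm
      simp only [lt_irrefl, if_true, if_false] at hy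
      split_ifs at hy <;> simp only [Prod.mk.injEq] at hy
      · omega
      · exact ⟨t, hy.2.1⟩
      · omega
    · simp only [hm.not_gt, hm.ne', if_false] at hy
      split_ifs at hy <;> simp only [Prod.mk.injEq] at hy
      · omega
      · exact ⟨_, hy.2.1⟩
      · omega
  · rintro ⟨i, s, j⟩
    obtain ⟨u, hu⟩ := h s
    exact ⟨(j, u, i), by simp [BRmul, hu]⟩
end

section
/- Let M be a monoid, θ : M → M a monoid homomorphism whose values are units, and τ a Hausdorff topology on M for which the multiplication of M is separately continuous and θ : (M,τ) → (M,τ) is continuous. Then the direct sum topology on the ℤ-Bruck–Reilly extension B(M,ℤ,θ) is Hausdorff and the multiplication of B(M,ℤ,θ) is separately continuous with respect to it. -/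
/-- The direct sum topology on `B(M, ℤ, θ) = ℤ × M × ℤ`: the product topology where
both copies of `ℤ` are discrete and `M` carries its given topology. -/
def dsTop (M : Type*) [tM : TopologicalSpace M] : TopologicalSpace (ℤ × M × ℤ) :=
  @instTopologicalSpaceProd ℤ (M × ℤ) ⊥ (@instTopologicalSpaceProd M ℤ tM ⊥)

/-- A map out of `ℤ × X × ℤ` is continuous once it is continuous on each slice `{i} × X × {j}`. -/
theorem continuous_of_continuous_slices {X Y : Type*} [TopologicalSpace X] [TopologicalSpace Y]
    {f : ℤ × X × ℤ → Y} (hf : ∀ i j : ℤ, Continuous fun s : X => f (i, s, j)) :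
    Continuous f := by
  refine continuous_prod_of_discrete_left.2 fun i => ?_
  exact continuous_prod_of_discrete_right.2 fun j => hf i j

theorem Monoid.End.continuous_pow {M : Type*} [Monoid M] [TopologicalSpace M]
    {θ : Monoid.End M} (hθ : Continuous fun s : M => θ s) (n : ℕ) :
    Continuous fun s : M => (θ ^ n) s := by
  rw [Monoid.End.coe_pow]
  exact hθ.iterate n

/-- If `M` is a Hausdorff semitopological monoid (separately continuous multiplication)
and `θ` is continuous, then the direct sum topology on `B(M, ℤ, θ)` is Hausdorff and the
multiplication of `B(M, ℤ, θ)` is separately continuous with respect to it. -/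
theorem BRmul_dsTop_semitopological {M : Type*} [Monoid M] [tM : TopologicalSpace M]
    [T2Space M] (θ : Monoid.End M) (hθ : ∀ s : M, IsUnit (θ s))
    (hlM : ∀ a : M, Continuous fun x : M => a * x)
    (hrM : ∀ a : M, Continuous fun x : M => x * a)
    (hθc : Continuous fun s : M => θ s) :
    @T2Space _ (dsTop M) ∧
    (∀ a : ℤ × M × ℤ, @Continuous _ _ (dsTop M) (dsTop M) fun x => BRmul θ a x) ∧
    (∀ a : ℤ × M × ℤ, @Continuous _ _ (dsTop M) (dsTop M) fun x => BRmul θ x a) := by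
  have htop : dsTop M = instTopologicalSpaceProd := rfl
  rw [htop]
  refine ⟨inferInstance, fun ⟨i, a, j⟩ => ?_, fun ⟨i, a, j⟩ => ?_⟩ <;>
    refine continuous_of_continuous_slices fun m n => ?_ <;>
    simp only [BRmul] <;>
    split_ifs <;>
    refine continuous_const.prodMk (Continuous.prodMk ?_ continuous_const)
  · exact hlM _
  · exact hlM _
  · exact (hlM _).comp (Monoid.End.continuous_pow hθc _)
  · exact (hrM _).comp (Monoid.End.continuous_pow hθc _)
  · exact hrM _
  · exact hrM _
end

section
/- Let M be a monoid, θ : M → M a monoid homomorphism whose values are units, and let t be a Hausdorff topology on the ℤ-Bruck–Reilly extension B(M,ℤ,θ) for which the multiplication of B(M,ℤ,θ) is separately continuous. Then for all i,j,k,l ∈ ℤ the map (i,s,j) ↦ (k,s,l) is a homeomorphism of the subspace S_{i,j} onto the subspace S_{k,l}; moreover, for all i,k ∈ ℤ the map (i,s,i) ↦ (k,s,k) is a topological isomorphism (a multiplicative homeomorphism) between the subsemigroups S_{i,i} and S_{k,k}. -/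
theorem BRmul_of_eq {M : Type*} [Monoid M] (θ : Monoid.End M) (i j n : ℤ) (s s' : M) :
    BRmul θ (i, s, j) (j, s', n) = (i, s * s', n) := by
  simp [BRmul]

/-- The map `(i, s, j) ↦ (k, s, l)` is multiplication by `(k, 1, i)` on the left and by
`(j, 1, l)` on the right, so it is continuous. -/
theorem continuous_BRmul_slice_map {M : Type*} [Monoid M] (θ : Monoid.End M)
    (t : TopologicalSpace (ℤ × M × ℤ))
    (hl : ∀ a : ℤ × M × ℤ, @Continuous _ _ t t fun x => BRmul θ a x)
    (hr : ∀ a : ℤ × M × ℤ, @Continuous _ _ t t fun x => BRmul θ x a) (i j k l : ℤ) :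
    @Continuous {p : ℤ × M × ℤ // p.1 = i ∧ p.2.2 = j}
      {p : ℤ × M × ℤ // p.1 = k ∧ p.2.2 = l}
      (t.induced Subtype.val) (t.induced Subtype.val)
      (fun p => ⟨(k, p.val.2.1, l), rfl, rfl⟩) := by
  refine continuous_induced_rng.2 ?_
  have h := (@Continuous.comp _ _ _ t t t _ _ (hr (j, 1, l)) (hl (k, 1, i))).comp
    (continuous_induced_dom (f := (Subtype.val : {p : ℤ × M × ℤ // p.1 = i ∧ p.2.2 = j} → _)))
  convert h using 1
  funext p
  obtain ⟨⟨_, s, _⟩, rfl, rfl⟩ := p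
  simp [BRmul_of_eq]

/-- If `t` is a Hausdorff topology on `B(M, ℤ, θ)` with separately continuous
multiplication, then for all `i j k l : ℤ` the map `(i, s, j) ↦ (k, s, l)` is a
homeomorphism of the subspace `S_{i,j}` onto `S_{k,l}`; moreover, for all `i k : ℤ`
the map `(i, s, i) ↦ (k, s, k)` is a topological isomorphism (a multiplicative
homeomorphism) between the subsemigroups `S_{i,i}` and `S_{k,k}`. -/
theorem BRmul_slices_homeomorphic {M : Type*} [Monoid M] (θ : Monoid.End M)
    (hθ : ∀ s : M, IsUnit (θ s))
    (t : TopologicalSpace (ℤ × M × ℤ)) (ht2 : @T2Space _ t)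
    (hl : ∀ a : ℤ × M × ℤ, @Continuous _ _ t t fun x => BRmul θ a x)
    (hr : ∀ a : ℤ × M × ℤ, @Continuous _ _ t t fun x => BRmul θ x a) :
    (∀ i j k l : ℤ,
      @IsHomeomorph {p : ℤ × M × ℤ // p.1 = i ∧ p.2.2 = j}
        {p : ℤ × M × ℤ // p.1 = k ∧ p.2.2 = l}
        (t.induced Subtype.val) (t.induced Subtype.val)
        (fun p => ⟨(k, p.val.2.1, l), rfl, rfl⟩)) ∧
    (∀ i k : ℤ,
      @IsHomeomorph {p : ℤ × M × ℤ // p.1 = i ∧ p.2.2 = i}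
        {p : ℤ × M × ℤ // p.1 = k ∧ p.2.2 = k}
        (t.induced Subtype.val) (t.induced Subtype.val)
        (fun p => ⟨(k, p.val.2.1, k), rfl, rfl⟩) ∧
      ∀ s s' : M,
        (k, (BRmul θ (i, s, i) (i, s', i)).2.1, k) = BRmul θ (k, s, k) (k, s', k)) := by
  have homeo : ∀ i j k l : ℤ,
      @IsHomeomorph {p : ℤ × M × ℤ // p.1 = i ∧ p.2.2 = j}
        {p : ℤ × M × ℤ // p.1 = k ∧ p.2.2 = l}
        (t.induced Subtype.val) (t.induced Subtype.val)
        (fun p => ⟨(k, p.val.2.1, l), rfl, rfl⟩) := by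
    intro i j k l
    let _ : TopologicalSpace {p : ℤ × M × ℤ // p.1 = i ∧ p.2.2 = j} := t.induced Subtype.val
    let _ : TopologicalSpace {p : ℤ × M × ℤ // p.1 = k ∧ p.2.2 = l} := t.induced Subtype.val
    refine isHomeomorph_iff_exists_inverse.2
      ⟨continuous_BRmul_slice_map θ t hl hr i j k l, _, ?_, ?_,
        continuous_BRmul_slice_map θ t hl hr k l i j⟩
    · rintro ⟨⟨_, s, _⟩, rfl, rfl⟩
      rfl
    · rintro ⟨⟨_, s, _⟩, rfl, rfl⟩
      rfl
  exact ⟨homeo, fun i k => ⟨homeo i i k k, fun s s' => by simp [BRmul_of_eq]⟩⟩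
end

section
/- Let M be a monoid, θ : M → M a monoid homomorphism whose values are units, and let t be a Hausdorff topology on the ℤ-Bruck–Reilly extension B(M,ℤ,θ) for which the multiplication of B(M,ℤ,θ) is separately continuous. Then for every element (i,s,j) of B(M,ℤ,θ) there exists a t-open neighbourhood U of (i,s,j) such that U ⊆ ⋃_{k=0}^{∞} S_{i−k,j−k}. -/
theorem BRmul_idempotent_left_eq_self_iff {M : Type*} [Monoid M] (θ : Monoid.End M) (n : ℤ)
    (x : ℤ × M × ℤ) : BRmul θ (n, 1, n) x = x ↔ n ≤ x.1 := by
  obtain ⟨a, u, b⟩ := x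
  rcases lt_trichotomy n a with h | rfl | h
  · simp [BRmul, h, h.le]
  · simp [BRmul]
  · simp [BRmul, h, h.not_gt, h.ne']

theorem BRmul_idempotent_right_eq_self_iff {M : Type*} [Monoid M] (θ : Monoid.End M) (n : ℤ)
    (x : ℤ × M × ℤ) : BRmul θ x (n, 1, n) = x ↔ n ≤ x.2.2 := by
  obtain ⟨a, u, b⟩ := x
  rcases lt_trichotomy b n with h | rfl | h
  · simp [BRmul, h, h.ne']
  · simp [BRmul]
  · simp [BRmul, h.not_gt, h.ne', h.le]

/-- If the first coordinate of `x` is at most `i` and the product of the idempotent at `i`, `x`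
and the idempotent at `j` does not exceed `(i, j)` in either outer coordinate, then `x` lies on
the diagonal through `(i, j)`. -/
theorem BRmul_idempotents_diagonal {M : Type*} [Monoid M] (θ : Monoid.End M) (i j : ℤ)
    (x : ℤ × M × ℤ) (hx : x.1 ≤ i)
    (h₁ : (BRmul θ (BRmul θ (i, 1, i) x) (j, 1, j)).1 ≤ i)
    (h₂ : (BRmul θ (BRmul θ (i, 1, i) x) (j, 1, j)).2.2 ≤ j) : x.1 - x.2.2 = i - j := by
  obtain ⟨a, u, b⟩ := x
  simp only [BRmul] at h₁ h₂ hx ⊢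
  split_ifs at h₁ h₂ <;> simp only at * <;> omega

/-- If `t` is a Hausdorff topology on `B(M, ℤ, θ)` with separately continuous
multiplication, then every point `(i, s, j)` has a `t`-open neighbourhood contained in
`⋃_{k ≥ 0} S_{i-k, j-k}`. -/
theorem BRmul_nbhd_in_diagonal_union {M : Type*} [Monoid M] (θ : Monoid.End M)
    (hθ : ∀ s : M, IsUnit (θ s))
    (t : TopologicalSpace (ℤ × M × ℤ)) (ht2 : @T2Space _ t)
    (hl : ∀ a : ℤ × M × ℤ, @Continuous _ _ t t fun x => BRmul θ a x)
    (hr : ∀ a : ℤ × M × ℤ, @Continuous _ _ t t fun x => BRmul θ x a) :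
    ∀ (i : ℤ) (s : M) (j : ℤ), ∃ U : Set (ℤ × M × ℤ),
      t.IsOpen U ∧ (i, s, j) ∈ U ∧
      U ⊆ ⋃ k : ℕ, {p : ℤ × M × ℤ | p.1 = i - k ∧ p.2.2 = j - k} := by
  intro i s j
  have isOpen_fst : ∀ n : ℤ, IsOpen {x : ℤ × M × ℤ | x.1 ≤ n} := fun n => by
    have h := (isClosed_eq (hl (n + 1, 1, n + 1)) continuous_id).isOpen_compl
    convert h using 1
    ext x
    simp [BRmul_idempotent_left_eq_self_iff]
  have isOpen_snd : ∀ n : ℤ, IsOpen {x : ℤ × M × ℤ | x.2.2 ≤ n} := fun n => by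
    have h := (isClosed_eq (hr (n + 1, 1, n + 1)) continuous_id).isOpen_compl
    convert h using 1
    ext x
    simp [BRmul_idempotent_right_eq_self_iff]
  have hquadrant := (isOpen_fst i).inter (isOpen_snd j)
  have hcont := (hr (j, 1, j)).comp (hl (i, 1, i))
  refine ⟨_, hquadrant.inter (hquadrant.preimage hcont), ?_, ?_⟩
  · simp [BRmul]
  · rintro x ⟨⟨hx, -⟩, h₁, h₂⟩
    have hd := BRmul_idempotents_diagonal θ i j x hx h₁ h₂
    have hx' : x.1 ≤ i := hx
    refine Set.mem_iUnion.2 ⟨(i - x.1).toNat, ?_, ?_⟩ <;> omega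
end

section
/- Let M be a monoid, θ : M → M a monoid homomorphism whose values are units, and τ a Hausdorff topology on M with separately continuous multiplication and continuous θ. Let t be a Hausdorff topology on the ℤ-Bruck–Reilly extension B(M,ℤ,θ) for which the multiplication of B(M,ℤ,θ) is separately continuous and such that for some m ∈ ℤ the map s ↦ (m,s,m) is a homeomorphism from (M,τ) onto the subspace S_{m,m} of (B(M,ℤ,θ),t). If M contains a compact left ideal, i.e. a nonempty τ-compact subset L with M·L ⊆ L, then t equals the direct sum topology determined by τ. -/
open Topology

namespace BRmul

variable {M : Type*} [Monoid M] {θ : Monoid.End M}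

theorem mk_of_le {i j p n : ℤ} (s r : M) (h : j ≤ p) :
    BRmul θ (i, s, j) (p, r, n) = (i - j + p, (θ ^ (p - j).toNat) s * r, n) := by
  rcases h.lt_or_eq with h | rfl
  · simp [BRmul, h]
  · simp [BRmul]

theorem mk_of_ge {i j p n : ℤ} (s r : M) (h : p ≤ j) :
    BRmul θ (i, s, j) (p, r, n) = (i, s * (θ ^ (j - p).toNat) r, n - p + j) := by
  rcases h.lt_or_eq with h | rfl
  · simp [BRmul, h.ne', h.not_gt]
  · simp [BRmul]

theorem mk_self (i j n : ℤ) (s r : M) :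
    BRmul θ (i, s, j) (j, r, n) = (i, s * r, n) := by
  simp [BRmul]

variable {t : TopologicalSpace (ℤ × M × ℤ)}

theorem isOpen_fst_le (ht2 : @T2Space _ t)
    (hl : ∀ a : ℤ × M × ℤ, @Continuous _ _ t t fun x => BRmul θ a x) (k : ℤ) :
    IsOpen[t] {x : ℤ × M × ℤ | x.1 ≤ k} := by
  have hfix : {x : ℤ × M × ℤ | x.1 ≤ k}ᶜ =
      {x | BRmul θ (k + 1, 1, k + 1) x = x} := by
    ext ⟨i, s, j⟩
    rcases le_or_gt (k + 1) i with h | h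
    · simp [mk_of_le _ _ h]
      omega
    · simp [mk_of_ge _ _ h.le]
      omega
  let := t
  rw [← isClosed_compl_iff, hfix]
  exact isClosed_eq (hl _) continuous_id

theorem isOpen_snd_le (ht2 : @T2Space _ t)
    (hr : ∀ a : ℤ × M × ℤ, @Continuous _ _ t t fun x => BRmul θ x a) (k : ℤ) :
    IsOpen[t] {x : ℤ × M × ℤ | x.2.2 ≤ k} := by
  have hfix : {x : ℤ × M × ℤ | x.2.2 ≤ k}ᶜ =
      {x | BRmul θ x (k + 1, 1, k + 1) = x} := by
    ext ⟨i, s, j⟩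
    rcases le_or_gt (k + 1) j with h | h
    · simp [mk_of_ge _ _ h]
      omega
    · simp [mk_of_le _ _ h.le]
      omega
  let := t
  rw [← isClosed_compl_iff, hfix]
  exact isClosed_eq (hr _) continuous_id

/-- Every slice `S_{k,l}` is open: an element of index strictly below `(k, l)` on the diagonal
through `(k, l)` is sent into the closed set `{m} × L × {m}` by a two-sided translation
which sends `S_{k,l}` into `S_{m+1,m+1}`. -/
theorem isOpen_slice (ht2 : @T2Space _ t)
    (hl : ∀ a : ℤ × M × ℤ, @Continuous _ _ t t fun x => BRmul θ a x)
    (hr : ∀ a : ℤ × M × ℤ, @Continuous _ _ t t fun x => BRmul θ x a)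
    {m : ℤ} {L : Set M} (hLne : L.Nonempty)
    (hLclosed : IsClosed[t] ((fun s : M => ((m, s, m) : ℤ × M × ℤ)) '' L))
    (hLideal : ∀ a : M, ∀ x ∈ L, a * x ∈ L) (k l : ℤ) :
    IsOpen[t] {x : ℤ × M × ℤ | x.1 = k ∧ x.2.2 = l} := by
  obtain ⟨f, hf⟩ := hLne
  have hsub : {x : ℤ × M × ℤ | x.1 = k ∧ x.2.2 = l} =
      {x | x.1 ≤ k} ∩ {x | x.2.2 ≤ l} ∩
      (fun x => BRmul θ (BRmul θ (m, 1, k) x) (l, 1, m)) ⁻¹'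
        ({x | x.1 ≤ m} ∩ {x | x.2.2 ≤ m}) ∩
      (fun x => BRmul θ (BRmul θ (m, 1, k - 1) x) (l - 1, f, m)) ⁻¹'
        ((fun s : M => ((m, s, m) : ℤ × M × ℤ)) '' L)ᶜ := by
    ext ⟨a, s, b⟩
    simp only [Set.mem_ofPred_eq, Set.mem_inter_iff, Set.mem_preimage, Set.mem_compl_iff]
    constructor
    · rintro ⟨rfl, rfl⟩
      refine ⟨⟨⟨le_rfl, le_rfl⟩, ?_⟩, ?_⟩
      · simp [mk_self]
      · rw [mk_of_le _ _ (sub_one_lt a).le, mk_of_ge _ _ (sub_one_lt b).le]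
        rintro ⟨_, _, h⟩
        have : m = m - (a - 1) + a := congrArg Prod.fst h
        omega
    · rintro ⟨⟨⟨ha, hb⟩, h⟩, hC⟩
      have hd : b - a + k = l := by
        rw [mk_of_ge _ _ ha] at h
        rcases le_total (b - a + k) l with hd | hd
        · rw [mk_of_le _ _ hd] at h
          have : m - (b - a + k) + l ≤ m := h.1
          omega
        · rw [mk_of_ge _ _ hd] at h
          have : m - l + (b - a + k) ≤ m := h.2
          omega
      by_contra hne
      have hak : a ≤ k - 1 := by omega
      rw [mk_of_ge _ _ hak, show b - a + (k - 1) = l - 1 by omega, mk_self] at hC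
      exact hC ⟨_, hLideal _ _ hf, rfl⟩
  let := t
  rw [hsub]
  exact (((isOpen_fst_le ht2 hl k).inter (isOpen_snd_le ht2 hr l)).inter
    (((isOpen_fst_le ht2 hl m).inter (isOpen_snd_le ht2 hr m)).preimage
      ((hr _).comp (hl _)))).inter (hLclosed.isOpen_compl.preimage ((hr _).comp (hl _)))

end BRmul

/-- The direct sum topology is characterised by its restrictions to the slices `S_{i,j}`. -/
theorem isOpen_dsTop_iff {M : Type*} [TopologicalSpace M] {U : Set (ℤ × M × ℤ)} :
    IsOpen[dsTop M] U ↔ ∀ i j : ℤ, IsOpen {s : M | (i, s, j) ∈ U} := by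
  have hbot : (⊥ : TopologicalSpace ℤ) = inferInstanceAs (TopologicalSpace ℤ) :=
    DiscreteTopology.eq_bot.symm
  rw [dsTop, hbot]
  constructor
  · intro hU i j
    exact hU.preimage (by fun_prop : Continuous fun s : M => (i, s, j))
  · intro h
    rw [isOpen_iff_mem_nhds]
    rintro ⟨i, s, j⟩ hs
    have hV := (isOpen_discrete {i}).prod ((h i j).prod (isOpen_discrete {j}))
    filter_upwards [hV.mem_nhds (show (i, s, j) ∈ _ from ⟨rfl, hs, rfl⟩)]
    rintro ⟨_, r, _⟩ ⟨rfl, hr, rfl⟩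
    exact hr

/-- If a topological ℤ-Bruck–Reilly extension `(B(M, ℤ, θ), t)` of a Hausdorff
semitopological monoid `(M, τ)` exists (i.e. `t` is a Hausdorff topology on
`B(M, ℤ, θ)` with separately continuous multiplication which induces the topology
`τ` on some slice `S_{m,m}`) and `M` contains a compact left ideal, then `t` is the
direct sum topology. -/
theorem BRmul_compact_left_ideal_dsTop {M : Type*} [Monoid M] [tM : TopologicalSpace M]
    [T2Space M] (θ : Monoid.End M) (hθ : ∀ s : M, IsUnit (θ s))
    (hlM : ∀ a : M, Continuous fun x : M => a * x)
    (hrM : ∀ a : M, Continuous fun x : M => x * a)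
    (hθc : Continuous fun s : M => θ s)
    (t : TopologicalSpace (ℤ × M × ℤ)) (ht2 : @T2Space _ t)
    (hl : ∀ a : ℤ × M × ℤ, @Continuous _ _ t t fun x => BRmul θ a x)
    (hr : ∀ a : ℤ × M × ℤ, @Continuous _ _ t t fun x => BRmul θ x a)
    (m : ℤ)
    (hm : @IsHomeomorph M {p : ℤ × M × ℤ // p.1 = m ∧ p.2.2 = m} tM
      (t.induced Subtype.val) (fun s => ⟨(m, s, m), rfl, rfl⟩))
    (L : Set M) (hLne : L.Nonempty) (hLcompact : IsCompact L)
    (hLideal : ∀ a : M, ∀ x ∈ L, a * x ∈ L) :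
    t = dsTop M := by
  let ι : M → ℤ × M × ℤ := fun s => (m, s, m)
  have hι : @IsInducing _ _ tM t ι := by
    let := t
    exact IsInducing.subtypeVal.comp hm.isInducing
  have hLclosed : IsClosed[t] (ι '' L) := by
    let := t
    exact (hLcompact.image hι.continuous).isClosed
  refine TopologicalSpace.ext_iff.2 fun U => ?_
  rw [isOpen_dsTop_iff]
  let := t
  constructor
  · intro hU i j
    have hc : Continuous fun s : M => BRmul θ (BRmul θ (i, 1, m) (ι s)) (m, 1, j) :=
      (hr _).comp ((hl _).comp hι.continuous)
    simpa [ι, BRmul.mk_self, Set.preimage] using hU.preimage hc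
  · intro hU
    refine isOpen_iff_forall_mem_open.2 ?_
    rintro ⟨k, s, l⟩ hs
    obtain ⟨W, hW, hWU⟩ := hι.isOpen_iff.1 (hU k l)
    have hmem (r : M) : (m, r, m) ∈ W ↔ (k, r, l) ∈ U := Set.ext_iff.1 hWU r
    refine ⟨{x | x.1 = k ∧ x.2.2 = l} ∩
      (fun x => BRmul θ (BRmul θ (m, 1, k) x) (l, 1, m)) ⁻¹' W, ?_,
      (BRmul.isOpen_slice ht2 hl hr hLne hLclosed hLideal k l).inter
        (hW.preimage ((hr _).comp (hl _))), ?_⟩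
    · rintro ⟨_, r, _⟩ ⟨⟨rfl, rfl⟩, hx⟩
      simpa [BRmul.mk_self, hmem] using hx
    · simpa [BRmul.mk_self, hmem] using hs
end

section
/- Every Hausdorff topology on the extended bicyclic semigroup C_ℤ for which the multiplication of C_ℤ is separately continuous is the discrete topology. -/
/-- The multiplication of the extended bicyclic semigroup `C_ℤ` on `ℤ × ℤ`. -/
def ebMul : ℤ × ℤ → ℤ × ℤ → ℤ × ℤ :=
  fun x y =>
    if x.2 < y.1 then (x.1 - x.2 + y.1, y.2)
    else if x.2 = y.1 then (x.1, y.2)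
    else (x.1, y.2 - y.1 + x.2)

/-- In a Hausdorff topology with continuous translations, every lower-left quadrant of `C_ℤ` is
open: its complement is a union of two fixed-point sets of translations by idempotents. -/
theorem isOpen_quadrant [TopologicalSpace (ℤ × ℤ)] [T2Space (ℤ × ℤ)]
    (hl : ∀ a : ℤ × ℤ, Continuous fun x => ebMul a x)
    (hr : ∀ a : ℤ × ℤ, Continuous fun x => ebMul x a) (a b : ℤ) :
    IsOpen {x : ℤ × ℤ | x.1 ≤ a ∧ x.2 ≤ b} := by
  have h1 := (isClosed_eq (hl (a + 1, a + 1)) continuous_id).isOpen_compl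
  have h2 := (isClosed_eq (hr (b + 1, b + 1)) continuous_id).isOpen_compl
  convert h1.inter h2 using 1
  ext ⟨c, d⟩
  simp only [ebMul, Set.mem_ofPred_eq, Set.mem_inter_iff, Set.mem_compl_iff, id]
  split_ifs <;> simp only [Prod.mk.injEq, true_and, and_true] <;> omega

/-- Every Hausdorff topology on the extended bicyclic semigroup `C_ℤ` for which the
multiplication is separately continuous is the discrete topology. -/
theorem extended_bicyclic_discrete (t : TopologicalSpace (ℤ × ℤ)) (ht2 : @T2Space _ t)
    (hl : ∀ a : ℤ × ℤ, @Continuous _ _ t t fun x => ebMul a x)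
    (hr : ∀ a : ℤ × ℤ, @Continuous _ _ t t fun x => ebMul x a) :
    t = ⊥ := by
  refine DiscreteTopology.eq_bot (self := discreteTopology_iff_isOpen_singleton.mpr ?_)
  rintro ⟨a, b⟩
  have hU := isOpen_quadrant hl hr a b
  have hL := hU.preimage (hl (a, a))
  have hR := hU.preimage (hr (b, b))
  have hM := (isOpen_compl_singleton (x := ((a - 1, b - 1) : ℤ × ℤ))).preimage
    (hl (a - 1, a - 1))
  convert ((hU.inter hL).inter hR).inter hM using 1
  ext ⟨c, d⟩
  simp only [ebMul, Set.mem_singleton_iff, Set.mem_preimage, Set.mem_ofPred_eq,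
    Set.mem_inter_iff, Set.mem_compl_iff, Prod.mk.injEq]
  split_ifs <;> simp only [Prod.mk.injEq, true_and] <;> omega
end

section
/- Let M be a monoid, θ : M → M a monoid homomorphism whose values are units, and τ a Hausdorff topology on M such that the multiplication of M is jointly continuous, M is an inverse semigroup whose inversion s ↦ s⁻¹ is τ-continuous, and θ is τ-continuous. Let t be a Hausdorff topology on the ℤ-Bruck–Reilly extension B(M,ℤ,θ) for which the multiplication of B(M,ℤ,θ) is jointly continuous, the inversion (i,s,j) ↦ (j, s⁻¹, i) is continuous, and for some m ∈ ℤ the map s ↦ (m,s,m) is a homeomorphism from (M,τ) onto the subspace S_{m,m}. If the set of idempotents of M contains a minimal element e₀ (that is, e₀·e₀ = e₀ and every idempotent f with f·e₀ = e₀·f = f satisfies f = e₀), then t equals the direct sum topology determined by τ. -/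
section InverseSemigroup

variable {M : Type*} [Monoid M] {ι : M → M}

/-- In an inverse semigroup the product of two idempotents is idempotent. -/
lemma mul_idempotent_of_unique_inverse (hinv : ∀ x : M, x * ι x * x = x ∧ ι x * x * ι x = ι x)
    (huniq : ∀ x y : M, x * y * x = x → y * x * y = y → y = ι x)
    {e f : M} (he : e * e = e) (hf : f * f = f) : e * f * (e * f) = e * f := by
  obtain ⟨h1, h2⟩ := hinv (e * f)
  have key : f * ι (e * f) * e = ι (e * f) := by
    apply huniq
    · calc e * f * (f * ι (e * f) * e) * (e * f)
          = e * (f * f) * ι (e * f) * ((e * e) * f) := by simp only [mul_assoc]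
        _ = e * f := by rw [he, hf, h1]
    · calc f * ι (e * f) * e * (e * f) * (f * ι (e * f) * e)
          = f * (ι (e * f) * ((e * e) * (f * f)) * ι (e * f)) * e := by simp only [mul_assoc]
        _ = f * ι (e * f) * e := by rw [he, hf, h2]
  have hidem : ι (e * f) * ι (e * f) = ι (e * f) := by
    calc ι (e * f) * ι (e * f) = (f * ι (e * f) * e) * (f * ι (e * f) * e) := by rw [key]
      _ = f * (ι (e * f) * (e * f) * ι (e * f)) * e := by simp only [mul_assoc]
      _ = ι (e * f) := by rw [h2, key]
  have hself : ι (e * f) = e * f :=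
    (huniq _ _ (by rw [hidem, hidem]) (by rw [hidem, hidem])).trans (huniq _ _ h2 h1).symm
  rwa [hself] at hidem

/-- In an inverse semigroup idempotents commute. -/
lemma idempotent_mul_comm_of_unique_inverse
    (hinv : ∀ x : M, x * ι x * x = x ∧ ι x * x * ι x = ι x)
    (huniq : ∀ x y : M, x * y * x = x → y * x * y = y → y = ι x)
    {e f : M} (he : e * e = e) (hf : f * f = f) : e * f = f * e := by
  have hef := mul_idempotent_of_unique_inverse hinv huniq he hf
  have hfe := mul_idempotent_of_unique_inverse hinv huniq hf he
  refine (huniq (e * f) _ (by rw [hef, hef]) (by rw [hef, hef])).trans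
    (huniq (e * f) _ ?_ ?_).symm
  · calc e * f * (f * e) * (e * f) = e * (f * f) * ((e * e) * f) := by simp only [mul_assoc]
      _ = e * f := by rw [he, hf, hef]
  · calc f * e * (e * f) * (f * e) = f * (e * e) * ((f * f) * e) := by simp only [mul_assoc]
      _ = f * e := by rw [he, hf, hfe]

/-- In an inverse semigroup a minimal idempotent is the least idempotent. -/
lemma minimal_idempotent_mul (hinv : ∀ x : M, x * ι x * x = x ∧ ι x * x * ι x = ι x)
    (huniq : ∀ x y : M, x * y * x = x → y * x * y = y → y = ι x)
    {e₀ : M} (he₀ : e₀ * e₀ = e₀)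
    (hmin : ∀ f : M, f * f = f → f * e₀ = f → e₀ * f = f → f = e₀)
    {f : M} (hf : f * f = f) : e₀ * f = e₀ := by
  refine hmin _ (mul_idempotent_of_unique_inverse hinv huniq he₀ hf) ?_ (by rw [← mul_assoc, he₀])
  rw [idempotent_mul_comm_of_unique_inverse hinv huniq he₀ hf, mul_assoc, he₀]

end InverseSemigroup

section Algebra

variable {M : Type*} [Monoid M] (θ : Monoid.End M)

lemma pow_end_idempotent_eq_one (hθ : ∀ s : M, IsUnit (θ s)) {f : M} (hf : f * f = f)
    {n : ℕ} (hn : 0 < n) : (θ ^ n) f = 1 := by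
  obtain ⟨k, rfl⟩ := Nat.exists_eq_add_of_lt hn
  have hu : IsUnit ((θ ^ (0 + k + 1)) f) := by
    rw [pow_succ']
    exact hθ _
  apply hu.mul_left_cancel
  rw [← map_mul, hf, mul_one]

lemma BRmul_self_right (i j l : ℤ) (s u : M) :
    BRmul θ (i, s, j) (j, u, l) = (i, s * u, l) := by
  simp [BRmul]

lemma BRmul_one_left_eq_self_iff (i : ℤ) (x : ℤ × M × ℤ) :
    BRmul θ (i, 1, i) x = x ↔ i ≤ x.1 := by
  obtain ⟨k, s, l⟩ := x
  rcases lt_trichotomy i k with h | rfl | h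
  · simp [BRmul, h, h.le]
  · simp [BRmul]
  · simp [BRmul, h.not_gt, h.ne', h.not_ge]

lemma BRmul_minimal_eq_iff (hθ : ∀ s : M, IsUnit (θ s)) {e₀ f : M}
    (hf : f * f = f) (hef : e₀ * f = e₀) (i k : ℤ) :
    BRmul θ (i, e₀, i) (k, f, k) = (i, e₀, i) ↔ k ≤ i := by
  rcases lt_trichotomy i k with h | rfl | h
  · simp [BRmul, h, h.ne']
  · simp [BRmul, hef]
  · have h1 : (θ ^ (i - k).toNat) f = 1 := pow_end_idempotent_eq_one θ hθ hf (by omega)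
    simp [BRmul, h.not_gt, h.ne', h.le, h1]

end Algebra

section Topology

variable {M : Type*} [Monoid M] {θ : Monoid.End M}
  [t : TopologicalSpace (ℤ × M × ℤ)]

lemma isOpen_fst_eq [T2Space (ℤ × M × ℤ)] {ι : M → M}
    (hjc : Continuous fun p : (ℤ × M × ℤ) × (ℤ × M × ℤ) => BRmul θ p.1 p.2)
    (hinvc : Continuous fun x : ℤ × M × ℤ => (x.2.2, ι x.2.1, x.1))
    (hθ : ∀ s : M, IsUnit (θ s)) (hinv : ∀ x : M, x * ι x * x = x) {e₀ : M}
    (hmin : ∀ f : M, f * f = f → e₀ * f = e₀) (i : ℤ) :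
    IsOpen {x : ℤ × M × ℤ | x.1 = i} := by
  have hge : IsClosed {x : ℤ × M × ℤ | i + 1 ≤ x.1} := by
    simp only [← BRmul_one_left_eq_self_iff θ]
    exact isClosed_eq (hjc.comp (continuous_const.prodMk continuous_id)) continuous_id
  have hle : IsClosed {x : ℤ × M × ℤ | x.1 ≤ i - 1} := by
    have heq (x : ℤ × M × ℤ) : x.1 ≤ i - 1 ↔ BRmul θ (i - 1, e₀, i - 1)
        (BRmul θ x (x.2.2, ι x.2.1, x.1)) = (i - 1, e₀, i - 1) := by
      obtain ⟨k, s, l⟩ := x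
      have hs : s * ι s * (s * ι s) = s * ι s := by rw [← mul_assoc, hinv]
      rw [BRmul_self_right, BRmul_minimal_eq_iff θ hθ hs (hmin _ hs)]
    simp only [heq]
    exact isClosed_eq (hjc.comp (continuous_const.prodMk
      (hjc.comp (continuous_id.prodMk hinvc)))) continuous_const
  convert (hge.union hle).isOpen_compl using 1
  ext x
  simp only [Set.mem_ofPred_eq, Set.mem_compl_iff, Set.mem_union]
  omega

lemma continuous_BRmul_BRmul_const
    (hjc : Continuous fun p : (ℤ × M × ℤ) × (ℤ × M × ℤ) => BRmul θ p.1 p.2)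
    (a b : ℤ × M × ℤ) : Continuous fun x => BRmul θ (BRmul θ a x) b :=
  hjc.comp ((hjc.comp (continuous_const.prodMk continuous_id)).prodMk continuous_const)

lemma eq_dsTop_of_isOpen [tM : TopologicalSpace M]
    (hjc : Continuous fun p : (ℤ × M × ℤ) × (ℤ × M × ℤ) => BRmul θ p.1 p.2)
    {m : ℤ} (hm : Topology.IsInducing fun s : M => ((m, s, m) : ℤ × M × ℤ))
    (hfst : ∀ i : ℤ, IsOpen {x : ℤ × M × ℤ | x.1 = i})
    (hsnd : ∀ j : ℤ, IsOpen {x : ℤ × M × ℤ | x.2.2 = j}) :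
    t = dsTop M := by
  let _ : TopologicalSpace ℤ := ⊥
  have _ : DiscreteTopology ℤ := ⟨rfl⟩
  have hmid : @Continuous _ _ t tM fun x : ℤ × M × ℤ => x.2.1 := by
    refine continuous_iff_continuousAt.2 fun x => hm.continuousAt_iff.2 ?_
    refine (continuous_BRmul_BRmul_const hjc (m, 1, x.1) (x.2.2, 1, m)).continuousAt.congr ?_
    filter_upwards [(hfst x.1).mem_nhds rfl, (hsnd x.2.2).mem_nhds rfl] with ⟨k, s, l⟩ hk hl
    simp only at hk hl
    simp [← hk, ← hl, BRmul_self_right]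
  apply le_antisymm
  · exact le_inf (continuous_iff_le_induced.1 (continuous_discrete_rng.2 hfst))
      (continuous_iff_le_induced.1 (hmid.prodMk (continuous_discrete_rng.2 hsnd)))
  · have hemb (i j : ℤ) : @Continuous _ _ tM t fun s : M => ((i, s, j) : ℤ × M × ℤ) := by
      convert (continuous_BRmul_BRmul_const hjc (i, 1, m) (m, 1, j)).comp hm.continuous using 2
      simp [BRmul_self_right]
    refine continuous_id_iff_le.1 ?_
    exact (continuous_prod_of_discrete_left (α := ℤ) (β := M × ℤ)).2 fun i =>
      continuous_prod_of_discrete_right.2 fun j => hemb i j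

end Topology

/-- If a topological ℤ-Bruck–Reilly extension `(B(M, ℤ, θ), t)` of a Hausdorff
topological inverse monoid `(M, τ)` in the class of topological inverse semigroups
exists, and the band of idempotents of `M` contains a minimal idempotent, then `t`
is the direct sum topology. -/
theorem BRmul_minimal_idempotent_dsTop {M : Type*} [Monoid M] [tM : TopologicalSpace M]
    [T2Space M] (θ : Monoid.End M) (hθ : ∀ s : M, IsUnit (θ s))
    (hmul : Continuous fun p : M × M => p.1 * p.2)
    (ι : M → M)
    (hinv : ∀ x : M, x * ι x * x = x ∧ ι x * x * ι x = ι x)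
    (huniq : ∀ x y : M, x * y * x = x → y * x * y = y → y = ι x)
    (hιc : Continuous ι)
    (hθc : Continuous fun s : M => θ s)
    (t : TopologicalSpace (ℤ × M × ℤ)) (ht2 : @T2Space _ t)
    (hjc : @Continuous _ _ (@instTopologicalSpaceProd _ _ t t) t
      (fun p : (ℤ × M × ℤ) × (ℤ × M × ℤ) => BRmul θ p.1 p.2))
    (hinvc : @Continuous _ _ t t (fun x : ℤ × M × ℤ => (x.2.2, ι x.2.1, x.1)))
    (m : ℤ)
    (hm : @IsHomeomorph M {p : ℤ × M × ℤ // p.1 = m ∧ p.2.2 = m} tM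
      (t.induced Subtype.val) (fun s => ⟨(m, s, m), rfl, rfl⟩))
    (e₀ : M) (he₀ : e₀ * e₀ = e₀)
    (hmin : ∀ f : M, f * f = f → f * e₀ = f → e₀ * f = f → f = e₀) :
    t = dsTop M := by
  have hind : @Topology.IsInducing _ _ tM t fun s : M => ((m, s, m) : ℤ × M × ℤ) :=
    (@Topology.IsInducing.subtypeVal _ t _).comp hm.isInducing
  have hfst := isOpen_fst_eq hjc hinvc hθ (fun x => (hinv x).1)
    (fun f hf => minimal_idempotent_mul hinv huniq he₀ hmin hf)
  exact eq_dsTop_of_isOpen hjc hind hfst fun j => (hfst j).preimage hinvc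
end

section
/- Let (S,τ) be a Hausdorff topological space with an associative, jointly continuous multiplication such that S is an inverse semigroup with continuous inversion and S is Clifford (x·x⁻¹ = x⁻¹·x for all x ∈ S). Let E = E(S) be the set of idempotents of S with the natural partial order e ≤ f iff e·f = f·e = e, and assume E has no least element (there is no idempotent e with e ≤ f for every idempotent f). If at least one of the following holds: (1) for every x ∈ E there exist y ∈ E with y ≤ x and an open neighbourhood U_y of y in E whose closure in E is compact; (2) E is locally compact; (3) E is a U-semilattice; then (S,τ) is an OIP-semigroup. -/
/-- Idempotents of an inverse semigroup commute. -/
theorem idempotents_commute {S : Type*} [Semigroup S] (ι : S → S)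
    (hinv : ∀ x : S, x * ι x * x = x ∧ ι x * x * ι x = ι x)
    (huniq : ∀ x y : S, x * y * x = x → y * x * y = y → y = ι x)
    {e f : S} (he : e * e = e) (hf : f * f = f) : e * f = f * e := by
  have idem : ∀ {e f : S}, e * e = e → f * f = f → (e * f) * (e * f) = e * f := by
    intro e f he hf
    obtain ⟨h1, h2⟩ := hinv (e * f)
    generalize hx : ι (e * f) = x at h1 h2
    have h3 : f * x * e = x := by
      rw [← hx]
      refine huniq _ _ ?_ ?_ <;> rw [hx]
      · calc e * f * (f * x * e) * (e * f) = e * (f * f) * x * (e * e) * f := by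
              simp only [mul_assoc]
          _ = e * f * x * (e * f) := by rw [he, hf]; simp only [mul_assoc]
          _ = e * f := h1
      · calc f * x * e * (e * f) * (f * x * e) = f * (x * ((e * e) * (f * f)) * x) * e := by
              simp only [mul_assoc]
          _ = f * x * e := by rw [he, hf, h2]
    have h4 : x * x = x := by
      calc x * x = (f * x * e) * (f * x * e) := by rw [h3]
        _ = f * (x * (e * f) * x) * e := by simp only [mul_assoc]
        _ = x := by rw [h2, h3]
    have h5 : e * f = x :=
      (huniq x (e * f) h2 h1).trans (huniq x x (by rw [h4, h4]) (by rw [h4, h4])).symm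
    rw [h5, h4]
  have key : ∀ {e f : S}, e * e = e → f * f = f → e * f * (f * e) * (e * f) = e * f := by
    intro e f he hf
    calc e * f * (f * e) * (e * f) = e * (f * f) * (e * e) * f := by simp only [mul_assoc]
      _ = (e * f) * (e * f) := by rw [he, hf]; simp only [mul_assoc]
      _ = e * f := idem he hf
  exact (huniq (e * f) (e * f) (by rw [idem he hf, idem he hf])
    (by rw [idem he hf, idem he hf])).trans (huniq (e * f) (f * e) (key he hf) (key hf he)).symm

/-- If every element lies above some point of a compact set of idempotents, where idempotents
commute, then there is a least idempotent. -/
theorem exists_least_idempotent {S : Type*} [Semigroup S] [TopologicalSpace S] [T2Space S]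
    (hmul : Continuous fun p : S × S => p.1 * p.2)
    (hcomm : ∀ e f : S, e * e = e → f * f = f → e * f = f * e)
    {K : Set S} (hK : IsCompact K) (hKE : ∀ k ∈ K, k * k = k) (e₀ : S) (he₀ : e₀ * e₀ = e₀)
    (hup : ∀ f : S, f * f = f → ∃ k ∈ K, k * f = k) :
    ∃ e : S, e * e = e ∧ ∀ f : S, f * f = f → e * f = e ∧ f * e = e := by
  have : Nonempty {f : S // f * f = f} := ⟨⟨e₀, he₀⟩⟩
  have hclosed : ∀ f : S, IsClosed {k : S | k * f = k} := fun f =>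
    isClosed_eq (hmul.comp (continuous_id.prodMk continuous_const)) continuous_id
  obtain ⟨e, he⟩ := IsCompact.nonempty_iInter_of_directed_nonempty_isCompact_isClosed
    (fun f : {f : S // f * f = f} => K ∩ {k : S | k * f.1 = k})
    (by
      rintro ⟨f, hf⟩ ⟨g, hg⟩
      have hfg := hcomm f g hf hg
      refine ⟨⟨f * g, ?_⟩, ?_, ?_⟩
      · calc f * g * (f * g) = f * (g * f) * g := by simp only [mul_assoc]
          _ = (f * f) * (g * g) := by rw [← hfg]; simp only [mul_assoc]
          _ = f * g := by rw [hf, hg]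
      · rintro k ⟨hk, hkfg : k * (f * g) = k⟩
        refine ⟨hk, ?_⟩
        change k * f = k
        calc k * f = k * (f * g) * f := by rw [hkfg]
          _ = k * ((f * f) * g) := by rw [mul_assoc, mul_assoc f g f, ← hfg, mul_assoc f f g]
          _ = k := by rw [hf, hkfg]
      · rintro k ⟨hk, hkfg : k * (f * g) = k⟩
        refine ⟨hk, ?_⟩
        change k * g = k
        calc k * g = k * (f * g) * g := by rw [hkfg]
          _ = k * (f * (g * g)) := by simp only [mul_assoc]
          _ = k := by rw [hg, hkfg])
    (fun f => hup f.1 f.2)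
    (fun f => hK.inter_right (hclosed f.1))
    (fun f => hK.isClosed.inter (hclosed f.1))
  have he' := fun f hf => Set.mem_iInter.1 he ⟨f, hf⟩
  have hee := hKE e (he' e₀ he₀).1
  exact ⟨e, hee, fun f hf => ⟨(he' f hf).2, (hcomm f e hf hee).trans (he' f hf).2⟩⟩

/-- The elements `s` with `φ s` above some point of a compact set form a closed set. -/
theorem isClosed_setOf_exists_mul_eq {S T : Type*} [Mul S] [TopologicalSpace S] [T2Space S]
    [TopologicalSpace T] (hmul : Continuous fun p : S × S => p.1 * p.2)
    {φ : T → S} (hφ : Continuous φ) {K : Set S} (hK : IsCompact K) :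
    IsClosed {s : T | ∃ k ∈ K, k * φ s = k} := by
  have : CompactSpace K := isCompact_iff_compactSpace.1 hK
  have hcl : IsClosed {p : K × T | p.1.1 * φ p.2 = p.1.1} :=
    isClosed_eq (hmul.comp ((continuous_subtype_val.comp continuous_fst).prodMk
      (hφ.comp continuous_snd))) (continuous_subtype_val.comp continuous_fst)
  convert isClosedMap_snd_of_compactSpace _ hcl using 1
  ext s
  simp


/-- A topological space with multiplication has the open ideal property if there
is a family of open two-sided ideals such that every point has an open neighbourhood
disjoint from some member of the family. -/
def IsOIP (S : Type*) [Mul S] [TopologicalSpace S] : Prop :=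
  ∃ 𝓘 : Set (Set S),
    (∀ I ∈ 𝓘, I.Nonempty ∧ IsOpen I ∧ ∀ (a : S), ∀ x ∈ I, a * x ∈ I ∧ x * a ∈ I) ∧
    ∀ x : S, ∃ I ∈ 𝓘, ∃ U : Set S, IsOpen U ∧ x ∈ U ∧ U ∩ I = ∅

/-- Let `S` be a Hausdorff topological inverse Clifford semigroup whose semilattice of
idempotents `E(S)` has no least element.  If `E(S)` (with the subspace topology)
satisfies one of: (1) every point of `E(S)` dominates a point with an open
neighbourhood with compact closure; (2) `E(S)` is locally compact; (3) `E(S)` is a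
`U`-semilattice, then `S` is an OIP-semigroup. -/
theorem clifford_OIP {S : Type*} [Semigroup S] [TopologicalSpace S] [T2Space S]
    (hmul : Continuous fun p : S × S => p.1 * p.2)
    (ι : S → S)
    (hinv : ∀ x : S, x * ι x * x = x ∧ ι x * x * ι x = ι x)
    (huniq : ∀ x y : S, x * y * x = x → y * x * y = y → y = ι x)
    (hιc : Continuous ι)
    (hclifford : ∀ x : S, x * ι x = ι x * x)
    (hnoleast : ¬ ∃ e : S, e * e = e ∧ ∀ f : S, f * f = f → e * f = e ∧ f * e = e)
    (hcond :
      (∀ x : {e : S // e * e = e}, ∃ y : {e : S // e * e = e},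
        (y.val * x.val = y.val ∧ x.val * y.val = y.val) ∧
        ∃ U : Set {e : S // e * e = e}, IsOpen U ∧ y ∈ U ∧ IsCompact (closure U)) ∨
      LocallyCompactSpace {e : S // e * e = e} ∨
      (∀ x : {e : S // e * e = e}, ∀ U : Set {e : S // e * e = e},
        IsOpen U → x ∈ U →
        (∀ a ∈ U, ∀ b : {e : S // e * e = e},
          a.val * b.val = a.val ∧ b.val * a.val = a.val → b ∈ U) →
        ∃ y ∈ U, x ∈ interior {f : {e : S // e * e = e} |
          y.val * f.val = y.val ∧ f.val * y.val = y.val})) :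
    IsOIP S := by
  have hcomm : ∀ e f : S, e * e = e → f * f = f → e * f = f * e := fun e f he hf =>
    idempotents_commute ι hinv huniq he hf
  have hπc : Continuous fun s : S => s * ι s := hmul.comp (continuous_id.prodMk hιc)
  have hπE : ∀ s : S, (s * ι s) * (s * ι s) = s * ι s := fun s => by
    rw [← mul_assoc, (hinv s).1]
  have hπid : ∀ e : S, e * e = e → e * ι e = e := fun e he => by
    rw [← huniq e e (by rw [he, he]) (by rw [he, he]), he]
  have hπl : ∀ a s : S, (a * s * ι (a * s)) * (s * ι s) = a * s * ι (a * s) := fun a s => by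
    rw [hclifford (a * s), hclifford s]
    calc ι (a * s) * (a * s) * (ι s * s) = ι (a * s) * (a * (s * ι s * s)) := by
          simp only [mul_assoc]
      _ = ι (a * s) * (a * s) := by rw [(hinv s).1]
  have hπr : ∀ a s : S, (s * a * ι (s * a)) * (s * ι s) = s * a * ι (s * a) := fun a s => by
    rw [hcomm _ _ (hπE _) (hπE _)]
    calc s * ι s * (s * a * ι (s * a)) = (s * ι s * s) * a * ι (s * a) := by
          simp only [mul_assoc]
      _ = s * a * ι (s * a) := by rw [(hinv s).1]
  have compact_nhds : (∀ x : {e : S // e * e = e}, ∃ y : {e : S // e * e = e},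
        (y.val * x.val = y.val ∧ x.val * y.val = y.val) ∧
        ∃ U : Set {e : S // e * e = e}, IsOpen U ∧ y ∈ U ∧ IsCompact (closure U)) →
      ∀ x : {e : S // e * e = e}, ∃ K : Set {e : S // e * e = e}, IsCompact K ∧
        ∃ V : Set {e : S // e * e = e}, IsOpen V ∧ x ∈ V ∧
          ∀ v ∈ V, ∃ k ∈ K, k.1 * v.1 = k.1 := by
    intro h x
    obtain ⟨y, ⟨hyx, -⟩, U, hU, hyU, hUc⟩ := h x
    have hmem : ∀ v : {e : S // e * e = e}, (y.1 * v.1) * (y.1 * v.1) = y.1 * v.1 := fun v => by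
      calc (y.1 * v.1) * (y.1 * v.1) = y.1 * (v.1 * y.1) * v.1 := by simp only [mul_assoc]
        _ = (y.1 * y.1) * (v.1 * v.1) := by
          rw [hcomm v.1 y.1 v.2 y.2]; simp only [mul_assoc]
        _ = y.1 * v.1 := by rw [y.2, v.2]
    have hcont : Continuous fun v : {e : S // e * e = e} =>
        (⟨y.1 * v.1, hmem v⟩ : {e : S // e * e = e}) :=
      (hmul.comp (continuous_const.prodMk continuous_subtype_val)).subtype_mk _
    refine ⟨closure U, hUc, _, hU.preimage hcont, ?_, fun v hv => ⟨_, subset_closure hv, ?_⟩⟩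
    · have : (⟨y.1 * x.1, hmem x⟩ : {e : S // e * e = e}) = y := Subtype.ext hyx
      rwa [Set.mem_preimage, this]
    · rw [mul_assoc, v.2]
  have hloc : ∀ x : {e : S // e * e = e}, ∃ K : Set {e : S // e * e = e}, IsCompact K ∧
      ∃ V : Set {e : S // e * e = e}, IsOpen V ∧ x ∈ V ∧
        ∀ v ∈ V, ∃ k ∈ K, k.1 * v.1 = k.1 := by
    rcases hcond with h | h | h
    · exact compact_nhds h
    · refine compact_nhds fun x => ⟨x, ⟨x.2, x.2⟩, ?_⟩
      obtain ⟨K, hK, hxK⟩ := exists_compact_mem_nhds x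
      exact ⟨interior K, isOpen_interior, mem_interior_iff_mem_nhds.2 hxK,
        hK.closure_of_subset interior_subset⟩
    · intro x
      obtain ⟨y, -, hy⟩ := h x Set.univ isOpen_univ trivial fun _ _ _ _ => trivial
      exact ⟨{y}, isCompact_singleton, _, isOpen_interior, hy,
        fun v hv => ⟨y, rfl, (interior_subset hv).1⟩⟩
  refine ⟨{I | I.Nonempty ∧ IsOpen I ∧ ∀ (a : S), ∀ x ∈ I, a * x ∈ I ∧ x * a ∈ I},
    fun I hI => hI, fun x => ?_⟩
  obtain ⟨K, hK, V, hV, hxV, hVK⟩ := hloc ⟨x * ι x, hπE x⟩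
  have hK' : IsCompact (Subtype.val '' K) := hK.image continuous_subtype_val
  refine ⟨{s | ∃ k ∈ Subtype.val '' K, k * (s * ι s) = k}ᶜ, ⟨?_, ?_, ?_⟩,
    (fun s => (⟨s * ι s, hπE s⟩ : {e : S // e * e = e})) ⁻¹' V,
    hV.preimage (hπc.subtype_mk _), hxV, ?_⟩
  · by_contra hne
    rw [Set.not_nonempty_iff_eq_empty, Set.compl_empty_iff] at hne
    refine hnoleast (exists_least_idempotent hmul hcomm hK' ?_ _ (hπE x) fun f hf => ?_)
    · rintro _ ⟨k, -, rfl⟩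
      exact k.2
    · obtain ⟨k, hk, hkf⟩ := hne.ge (Set.mem_univ f)
      exact ⟨k, hk, by rwa [hπid f hf] at hkf⟩
  · exact (isClosed_setOf_exists_mul_eq hmul hπc hK').isOpen_compl
  · refine fun a s hs => ⟨?_, ?_⟩ <;> rintro ⟨k, hk, hks⟩ <;> refine hs ⟨k, hk, ?_⟩
    · rw [← hks, mul_assoc, hπl]
    · rw [← hks, mul_assoc, hπr]
  · refine Set.eq_empty_of_forall_notMem ?_
    rintro s ⟨hs, hs'⟩
    obtain ⟨k, hk, hks⟩ := hVK _ hs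
    exact hs' ⟨k, ⟨k, hk, rfl⟩, hks⟩
end

section
/- Let G be a group, θ : G → G a group homomorphism, and u : ℤ → G with u_n = e for n ≥ 1, and let t be a Hausdorff topology on the Warne semigroup B_W for which the multiplication of B_W is separately continuous. Then for all i,j,k,l ∈ ℤ the map x ↦ (k,e,i)·x·(j,e,l) restricts to a homeomorphism of the subspace G_{i,j} onto the subspace G_{k,l}; moreover, for all i,k ∈ ℤ the map (i,g,i) ↦ (k,e,i)·(i,g,i)·(i,e,k) is a topological isomorphism (a multiplicative homeomorphism) between the subgroups G_{i,i} and G_{k,k} of B_W. -/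
/-- The elements `f_{m,n}` of the Warne construction:
`f_{0,n} = e` and `f_{m,n} = θ^{m-1}(u_{n+1}) ⬝ θ^{m-2}(u_{n+2}) ⬝ … ⬝ u_{n+m}`. -/
def warneF {G : Type*} [Group G] (θ : Monoid.End G) (u : ℤ → G) : ℕ → ℤ → G
  | 0, _ => 1
  | m + 1, n => (θ ^ m) (u (n + 1)) * warneF θ u m (n + 1)

/-- The multiplication of the Warne semigroup `B_W` on `ℤ × G × ℤ`:
`(a,g,b)·(c,h,d) = (a, g·f_{b−c,c}⁻¹·θ^{b−c}(h)·f_{b−c,d}, d−c+b)` if `b ≥ c`, and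
`(a−b+c, f_{c−b,a}⁻¹·θ^{c−b}(g)·f_{c−b,b}·h, d)` if `b ≤ c`. -/
def warneMul {G : Type*} [Group G] (θ : Monoid.End G) (u : ℤ → G) :
    ℤ × G × ℤ → ℤ × G × ℤ → ℤ × G × ℤ :=
  fun x y =>
    if y.1 ≤ x.2.2 then
      (x.1,
        x.2.1 * (warneF θ u (x.2.2 - y.1).toNat y.1)⁻¹ *
          (θ ^ (x.2.2 - y.1).toNat) y.2.1 * warneF θ u (x.2.2 - y.1).toNat y.2.2,
        y.2.2 - y.1 + x.2.2)
    else
      (x.1 - x.2.2 + y.1,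
        (warneF θ u (y.1 - x.2.2).toNat x.1)⁻¹ *
          (θ ^ (y.1 - x.2.2).toNat) x.2.1 * warneF θ u (y.1 - x.2.2).toNat x.2.2 * y.2.1,
        y.2.2)

theorem warneMul_of_eq {G : Type*} [Group G] (θ : Monoid.End G) (u : ℤ → G)
    (a b d : ℤ) (g h : G) :
    warneMul θ u (a, g, b) (b, h, d) = (a, g * h, d) := by
  simp [warneMul, warneF]

theorem warneMul_slice {G : Type*} [Group G] (θ : Monoid.End G) (u : ℤ → G)
    (i j k l : ℤ) (g : G) :
    warneMul θ u (warneMul θ u (k, 1, i) (i, g, j)) (j, 1, l) = (k, g, l) := by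
  simp [warneMul_of_eq]

theorem mapsTo_warneMul_slice {G : Type*} [Group G] (θ : Monoid.End G) (u : ℤ → G)
    (i j k l : ℤ) :
    Set.MapsTo (fun x => warneMul θ u (warneMul θ u (k, 1, i) x) (j, 1, l))
      {p : ℤ × G × ℤ | p.1 = i ∧ p.2.2 = j} {p : ℤ × G × ℤ | p.1 = k ∧ p.2.2 = l} := by
  rintro ⟨_, g, _⟩ ⟨rfl, rfl⟩
  simp [warneMul_slice]

theorem isHomeomorph_warneMul_slice {G : Type*} [Group G] (θ : Monoid.End G) (u : ℤ → G)
    (t : TopologicalSpace (ℤ × G × ℤ))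
    (hl : ∀ a : ℤ × G × ℤ, @Continuous _ _ t t fun x => warneMul θ u a x)
    (hr : ∀ a : ℤ × G × ℤ, @Continuous _ _ t t fun x => warneMul θ u x a)
    (i j k l : ℤ) :
    @IsHomeomorph _ _ (t.induced Subtype.val) (t.induced Subtype.val)
      (Set.MapsTo.restrict _ _ _ (mapsTo_warneMul_slice θ u i j k l)) := by
  have hcont (i j k l : ℤ) :
      @Continuous _ _ (t.induced Subtype.val) (t.induced Subtype.val)
        (Set.MapsTo.restrict _ _ _ (mapsTo_warneMul_slice θ u i j k l)) :=
    @continuous_induced_rng _ _ _ _ _ (_) (_) |>.2 <|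
      @Continuous.comp _ _ _ (_) t t _ _
        (@Continuous.comp _ _ _ t t t _ _ (hr (j, 1, l)) (hl (k, 1, i)))
        (@continuous_induced_dom _ _ _ t)
  refine @IsHomeomorph.mk _ _ (_) (_) _ (hcont i j k l) ?_ ?_
  · refine @IsOpenMap.of_inverse _ _ (_) (_) _
      (Set.MapsTo.restrict _ _ _ (mapsTo_warneMul_slice θ u k l i j)) (hcont k l i j) ?_ ?_
    all_goals
      rintro ⟨⟨_, g, _⟩, rfl, rfl⟩
      simp [Set.MapsTo.restrict, Subtype.map, warneMul_slice]
  · refine Function.bijective_iff_has_inverse.2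
      ⟨Set.MapsTo.restrict _ _ _ (mapsTo_warneMul_slice θ u k l i j), ?_, ?_⟩
    all_goals
      rintro ⟨⟨_, g, _⟩, rfl, rfl⟩
      simp [Set.MapsTo.restrict, Subtype.map, warneMul_slice]

/-- If `t` is a Hausdorff topology on the Warne semigroup `B_W` with separately
continuous multiplication, then for all `i j k l : ℤ` the map `x ↦ (k,e,i)·x·(j,e,l)`
restricts to a homeomorphism of `G_{i,j}` onto `G_{k,l}`; moreover for all `i k : ℤ`
the map `x ↦ (k,e,i)·x·(i,e,k)` is a topological isomorphism (a multiplicative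
homeomorphism) of the subgroup `G_{i,i}` onto `G_{k,k}`. -/
theorem warne_slices_homeomorphic {G : Type*} [Group G] (θ : Monoid.End G) (u : ℤ → G)
    (hu : ∀ n : ℤ, 1 ≤ n → u n = 1)
    (t : TopologicalSpace (ℤ × G × ℤ)) (ht2 : @T2Space _ t)
    (hl : ∀ a : ℤ × G × ℤ, @Continuous _ _ t t fun x => warneMul θ u a x)
    (hr : ∀ a : ℤ × G × ℤ, @Continuous _ _ t t fun x => warneMul θ u x a) :
    (∀ i j k l : ℤ, ∃ h : Set.MapsTo
        (fun x => warneMul θ u (warneMul θ u (k, 1, i) x) (j, 1, l))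
        {p : ℤ × G × ℤ | p.1 = i ∧ p.2.2 = j} {p : ℤ × G × ℤ | p.1 = k ∧ p.2.2 = l},
      @IsHomeomorph _ _ (t.induced Subtype.val) (t.induced Subtype.val)
        (Set.MapsTo.restrict _ _ _ h)) ∧
    (∀ i k : ℤ,
      (∃ h : Set.MapsTo
          (fun x => warneMul θ u (warneMul θ u (k, 1, i) x) (i, 1, k))
          {p : ℤ × G × ℤ | p.1 = i ∧ p.2.2 = i} {p : ℤ × G × ℤ | p.1 = k ∧ p.2.2 = k},
        @IsHomeomorph _ _ (t.induced Subtype.val) (t.induced Subtype.val)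
          (Set.MapsTo.restrict _ _ _ h)) ∧
      ∀ x y : ℤ × G × ℤ,
        x ∈ {p : ℤ × G × ℤ | p.1 = i ∧ p.2.2 = i} →
        y ∈ {p : ℤ × G × ℤ | p.1 = i ∧ p.2.2 = i} →
        warneMul θ u (warneMul θ u (k, 1, i) (warneMul θ u x y)) (i, 1, k) =
          warneMul θ u (warneMul θ u (warneMul θ u (k, 1, i) x) (i, 1, k))
            (warneMul θ u (warneMul θ u (k, 1, i) y) (i, 1, k))) := by
  refine ⟨fun i j k l => ⟨_, isHomeomorph_warneMul_slice θ u t hl hr i j k l⟩, fun i k =>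
    ⟨⟨_, isHomeomorph_warneMul_slice θ u t hl hr i i k k⟩, ?_⟩⟩
  rintro ⟨a, g, b⟩ ⟨c, h, d⟩ ⟨hai, hbi⟩ ⟨hci, hdi⟩
  dsimp only at hai hbi hci hdi
  subst a b c d
  simp [warneMul_of_eq]
end

section
/- Let G be a group, θ : G → G a group homomorphism, and u : ℤ → G with u_n = e for n ≥ 1, and let t be a Hausdorff topology on the Warne semigroup B_W for which the multiplication of B_W is separately continuous. For each i ∈ ℤ let σ_i denote the topology on G induced from (B_W,t) by the injection g ↦ (i,g,i). Then σ_i = σ_k for all i,k ∈ ℤ, and θ : (G,σ_0) → (G,σ_0) is a continuous map. -/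
/-- Translating `(i, g, i)` by `(k, 1, i)` on the left and `(i, 1, k)` on the right
gives `(k, g, k)`. -/
theorem warneMul_warneMul_diag {G : Type*} [Group G] (θ : Monoid.End G) (u : ℤ → G)
    (i k : ℤ) (g : G) :
    warneMul θ u (warneMul θ u (k, 1, i) (i, g, i)) (i, 1, k) = (k, g, k) := by
  simp [warneMul, warneF]

/-- If `u₁ = 1`, then right translation by `(1, 1, 1)` maps `(0, g, 0)` to `(1, θ g, 1)`. -/
theorem warneMul_zero_diag_one {G : Type*} [Group G] (θ : Monoid.End G) (u : ℤ → G)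
    (hu : u 1 = 1) (g : G) :
    warneMul θ u (0, g, 0) (1, 1, 1) = (1, θ g, 1) := by
  simp [warneMul, warneF, hu]

/-- Continuity of translations makes the topology induced by `g ↦ (i, g, i)` finer than the
one induced by `g ↦ (k, g, k)`. -/
theorem induced_warne_diag_le {G : Type*} [Group G] (θ : Monoid.End G) (u : ℤ → G)
    (t : TopologicalSpace (ℤ × G × ℤ))
    (hl : ∀ a : ℤ × G × ℤ, @Continuous _ _ t t fun x => warneMul θ u a x)
    (hr : ∀ a : ℤ × G × ℤ, @Continuous _ _ t t fun x => warneMul θ u x a) (i k : ℤ) :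
    t.induced (fun g : G => ((i, g, i) : ℤ × G × ℤ)) ≤
      t.induced (fun g : G => ((k, g, k) : ℤ × G × ℤ)) := by
  rw [← continuous_iff_le_induced]
  have h := @Continuous.comp _ _ _ (_) t t _ _ ((hr (i, 1, k)).comp (hl (k, 1, i)))
    (continuous_induced_dom (f := fun g : G => ((i, g, i) : ℤ × G × ℤ)))
  simpa only [Function.comp_def, warneMul_warneMul_diag] using h

/-- If `t` is a Hausdorff topology on the Warne semigroup `B_W` with separately
continuous multiplication, and `σ_i` denotes the topology induced on `G` by the
injection `g ↦ (i, g, i)`, then all the topologies `σ_i` coincide and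
`θ : (G, σ_0) → (G, σ_0)` is continuous. -/
theorem warne_theta_continuous {G : Type*} [Group G] (θ : Monoid.End G) (u : ℤ → G)
    (hu : ∀ n : ℤ, 1 ≤ n → u n = 1)
    (t : TopologicalSpace (ℤ × G × ℤ)) (ht2 : @T2Space _ t)
    (hl : ∀ a : ℤ × G × ℤ, @Continuous _ _ t t fun x => warneMul θ u a x)
    (hr : ∀ a : ℤ × G × ℤ, @Continuous _ _ t t fun x => warneMul θ u x a) :
    (∀ i k : ℤ, t.induced (fun g : G => ((i, g, i) : ℤ × G × ℤ)) =
      t.induced (fun g : G => ((k, g, k) : ℤ × G × ℤ))) ∧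
    @Continuous G G (t.induced (fun g : G => ((0, g, 0) : ℤ × G × ℤ)))
      (t.induced (fun g : G => ((0, g, 0) : ℤ × G × ℤ))) (fun g => θ g) := by
  have h_eq (i k : ℤ) : t.induced (fun g : G => ((i, g, i) : ℤ × G × ℤ)) =
      t.induced (fun g : G => ((k, g, k) : ℤ × G × ℤ)) :=
    le_antisymm (induced_warne_diag_le θ u t hl hr i k) (induced_warne_diag_le θ u t hl hr k i)
  refine ⟨h_eq, ?_⟩
  refine continuous_iff_le_induced.2 ?_
  conv_rhs => rw [h_eq 0 1]
  rw [← continuous_iff_le_induced, continuous_induced_rng]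
  have h := @Continuous.comp _ _ _ (_) t t _ _ (hr (1, 1, 1))
    (continuous_induced_dom (f := fun g : G => ((0, g, 0) : ℤ × G × ℤ)))
  simpa only [Function.comp_def, warneMul_zero_diag_one θ u (hu 1 le_rfl)] using h
end

section
/- Let G be a group, θ : G → G a group homomorphism, and u : ℤ → G with u_n = e for n ≥ 1, and let t be a Hausdorff topology on the Warne semigroup B_W for which the multiplication of B_W is separately continuous. Then for every element (i,g,j) of B_W there exists a t-open neighbourhood U of (i,g,j) such that U ⊆ ⋃_{k=0}^{∞} G_{i−k,j−k}. -/
/-- Right multiplication by the idempotent `(c, e, c)` fixes exactly the elements whose last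
coordinate is at least `c`. -/
theorem warneMul_idem_right_eq_iff {G : Type*} [Group G] (θ : Monoid.End G) (u : ℤ → G)
    (x : ℤ × G × ℤ) (c : ℤ) : warneMul θ u x (c, 1, c) = x ↔ c ≤ x.2.2 := by
  obtain ⟨a, g, b⟩ := x
  by_cases h : c ≤ b
  · simp [warneMul, h]
  · simp only [warneMul, h, if_false, Prod.mk.injEq, iff_false]
    omega

/-- Left multiplication by the idempotent `(c, e, c)` fixes exactly the elements whose first
coordinate is at least `c`. -/
theorem warneMul_idem_left_eq_iff {G : Type*} [Group G] (θ : Monoid.End G) (u : ℤ → G)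
    (x : ℤ × G × ℤ) (c : ℤ) : warneMul θ u (c, 1, c) x = x ↔ c ≤ x.1 := by
  obtain ⟨a, g, b⟩ := x
  rcases lt_trichotomy a c with h | rfl | h
  · simp only [warneMul, h.le, if_true, Prod.mk.injEq]
    omega
  · simp [warneMul, warneF]
  · simp [warneMul, h.le, h.not_ge]

theorem warneMul_idem_left_snd_snd {G : Type*} [Group G] (θ : Monoid.End G) (u : ℤ → G)
    {x : ℤ × G × ℤ} {c : ℤ} (h : x.1 ≤ c) :
    (warneMul θ u (c, 1, c) x).2.2 = x.2.2 - x.1 + c := by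
  simp [warneMul, h]

theorem warneMul_idem_right_fst {G : Type*} [Group G] (θ : Monoid.End G) (u : ℤ → G)
    {x : ℤ × G × ℤ} {c : ℤ} (h : x.2.2 ≤ c) :
    (warneMul θ u x (c, 1, c)).1 = x.1 - x.2.2 + c := by
  by_cases h' : c ≤ x.2.2
  · simp [warneMul, le_antisymm h h']
  · simp [warneMul, h']

/-- If `t` is a Hausdorff topology on the Warne semigroup `B_W` with separately
continuous multiplication, then every point `(i, g, j)` has a `t`-open neighbourhood
contained in `⋃_{k ≥ 0} G_{i-k, j-k}`. -/
theorem warne_nbhd_in_diagonal_union {G : Type*} [Group G] (θ : Monoid.End G) (u : ℤ → G)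
    (hu : ∀ n : ℤ, 1 ≤ n → u n = 1)
    (t : TopologicalSpace (ℤ × G × ℤ)) (ht2 : @T2Space _ t)
    (hl : ∀ a : ℤ × G × ℤ, @Continuous _ _ t t fun x => warneMul θ u a x)
    (hr : ∀ a : ℤ × G × ℤ, @Continuous _ _ t t fun x => warneMul θ u x a) :
    ∀ (i : ℤ) (g : G) (j : ℤ), ∃ U : Set (ℤ × G × ℤ),
      t.IsOpen U ∧ (i, g, j) ∈ U ∧
      U ⊆ ⋃ k : ℕ, {p : ℤ × G × ℤ | p.1 = i - k ∧ p.2.2 = j - k} := by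
  intro i g j
  have hfst : IsOpen {x : ℤ × G × ℤ | x.1 ≤ i} := by
    have h := (isClosed_eq (hl (i + 1, 1, i + 1)) continuous_id).isOpen_compl
    convert h using 1
    ext x
    simp [warneMul_idem_left_eq_iff]
  have hsnd : IsOpen {x : ℤ × G × ℤ | x.2.2 ≤ j} := by
    have h := (isClosed_eq (hr (j + 1, 1, j + 1)) continuous_id).isOpen_compl
    convert h using 1
    ext x
    simp [warneMul_idem_right_eq_iff]
  refine ⟨({x | x.1 ≤ i} ∩ {x | x.2.2 ≤ j}) ∩
    ((fun x => warneMul θ u (i, 1, i) x) ⁻¹' {x | x.2.2 ≤ j} ∩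
      (fun x => warneMul θ u x (j, 1, j)) ⁻¹' {x | x.1 ≤ i}),
    t.isOpen_inter _ _ (t.isOpen_inter _ _ hfst hsnd)
      (t.isOpen_inter _ _ ((hl _).isOpen_preimage _ hsnd) ((hr _).isOpen_preimage _ hfst)),
    ?_, ?_⟩
  · simp [warneMul_idem_left_snd_snd, warneMul_idem_right_fst]
  · rintro x ⟨⟨hi, hj⟩, hij, hji⟩
    simp only [Set.mem_ofPred_eq, Set.mem_preimage] at hi hj hij hji
    rw [warneMul_idem_left_snd_snd θ u hi] at hij
    rw [warneMul_idem_right_fst θ u hj] at hji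
    simp only [Set.mem_iUnion, Set.mem_ofPred_eq]
    exact ⟨(i - x.1).toNat, by omega, by omega⟩
end

section
/- Let G be a group, θ : G → G a group homomorphism, and u : ℤ → G with u_n = e for n ≥ 1, and let t be a Hausdorff topology on the Warne semigroup B_W for which the multiplication of B_W is separately continuous. Then the set of idempotents of B_W, which equals {(n,e,n) : n ∈ ℤ}, is a discrete subspace of (B_W,t). -/
/-- The idempotents `(n, e, n)` multiply by taking maxima. -/
theorem warneMul_diag {G : Type*} [Group G] (θ : Monoid.End G) (u : ℤ → G) (m n : ℤ) :
    warneMul θ u (m, 1, m) (n, 1, n) = (max m n, 1, max m n) := by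
  rcases le_or_gt n m with h | h
  · simp [warneMul, h]
  · simp [warneMul, not_le.mpr h, h.le]

theorem warneMul_self_eq_iff {G : Type*} [Group G] (θ : Monoid.End G) (u : ℤ → G)
    (p : ℤ × G × ℤ) : warneMul θ u p p = p ↔ ∃ n : ℤ, p = (n, 1, n) := by
  constructor
  · obtain ⟨a, g, b⟩ := p
    intro h
    have hab : a = b := by
      simp only [warneMul] at h
      split_ifs at h <;> simp only [Prod.mk.injEq] at h <;> omega
    subst hab
    have hg : g = 1 := by simpa [warneMul, warneF] using h
    exact ⟨a, by rw [hg]⟩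
  · rintro ⟨n, rfl⟩
    simp [warneMul_diag]

/-- If `t` is a Hausdorff topology on the Warne semigroup `B_W` with separately
continuous multiplication, then the set of idempotents of `B_W` equals
`{(n, e, n) : n ∈ ℤ}` and it is a discrete subspace of `(B_W, t)`. -/
theorem warne_idempotents_discrete {G : Type*} [Group G] (θ : Monoid.End G) (u : ℤ → G)
    (hu : ∀ n : ℤ, 1 ≤ n → u n = 1)
    (t : TopologicalSpace (ℤ × G × ℤ)) (ht2 : @T2Space _ t)
    (hl : ∀ a : ℤ × G × ℤ, @Continuous _ _ t t fun x => warneMul θ u a x)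
    (hr : ∀ a : ℤ × G × ℤ, @Continuous _ _ t t fun x => warneMul θ u x a) :
    {p : ℤ × G × ℤ | warneMul θ u p p = p} =
      {p : ℤ × G × ℤ | ∃ n : ℤ, p = (n, 1, n)} ∧
    @DiscreteTopology {p : ℤ × G × ℤ // warneMul θ u p p = p}
      (t.induced Subtype.val) := by
  refine ⟨Set.ext fun p => warneMul_self_eq_iff θ u p, ?_⟩
  let _ : TopologicalSpace {p : ℤ × G × ℤ // warneMul θ u p p = p} := t.induced Subtype.val
  refine discreteTopology_iff_isOpen_singleton.mpr ?_
  rintro ⟨p, hp⟩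
  obtain ⟨n, rfl⟩ := (warneMul_self_eq_iff θ u p).mp hp
  have h_lower : IsOpen {x | warneMul θ u (n - 1, 1, n - 1) x ≠ (n - 1, 1, n - 1)} :=
    isOpen_ne_fun (hl _) continuous_const
  have h_upper : IsOpen {x | warneMul θ u (n + 1, 1, n + 1) x ≠ x} :=
    isOpen_ne_fun (hl _) continuous_id
  refine isOpen_induced_iff.mpr ⟨_, h_lower.inter h_upper, ?_⟩
  ext ⟨q, hq⟩
  obtain ⟨k, rfl⟩ := (warneMul_self_eq_iff θ u q).mp hq
  simp only [Set.mem_preimage, Set.mem_inter_iff, Set.mem_ofPred_eq, warneMul_diag, ne_eq,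
    Prod.mk.injEq, true_and, and_self, Set.mem_singleton_iff, Subtype.mk.injEq]
  omega
end

section
/- Let G be a group, θ : G → G a group homomorphism, and u : ℤ → G with u_n = e for n ≥ 1, and let t be a Hausdorff topology on the Warne semigroup B_W for which the multiplication of B_W is jointly continuous and for which there is a t-continuous map inv : B_W → B_W with x·inv(x)·x = x and inv(x)·x·inv(x) = inv(x) for all x ∈ B_W. Then for all i,j ∈ ℤ the set G_{i,j} = {i} × G × {j} (an H-class of B_W) is both open and closed in (B_W,t). -/
/-- A weak inverse of `x` in the Warne semigroup lies in the transposed `H`-class, and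
its middle coordinate is the group inverse of that of `x`. -/
theorem warneMul_inverse_eq {G : Type*} [Group G] {θ : Monoid.End G} {u : ℤ → G}
    {x y : ℤ × G × ℤ} (hx : warneMul θ u (warneMul θ u x y) x = x)
    (hy : warneMul θ u (warneMul θ u y x) y = y) : y = (x.2.2, x.2.1⁻¹, x.1) := by
  obtain ⟨a, g, b⟩ := x
  obtain ⟨c, h, d⟩ := y
  have hx₁ := congrArg Prod.fst hx
  have hx₂ := congrArg (fun p => p.2.2) hx
  have hy₁ := congrArg Prod.fst hy
  have hy₂ := congrArg (fun p => p.2.2) hy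
  obtain ⟨rfl, rfl⟩ : c = b ∧ d = a := by
    simp only [warneMul] at hx₁ hx₂ hy₁ hy₂
    constructor <;> split_ifs at hx₁ hx₂ hy₁ hy₂ <;> simp only at * <;> omega
  have hg : g * h * g = g := by simpa [warneMul, warneF] using hx
  simpa using eq_inv_of_mul_eq_one_right (mul_eq_right.mp hg)

theorem warneMul_mul_inverse {G : Type*} [Group G] (θ : Monoid.End G) (u : ℤ → G)
    (x : ℤ × G × ℤ) : warneMul θ u x (x.2.2, x.2.1⁻¹, x.1) = (x.1, 1, x.1) := by
  simp [warneMul, warneF]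

theorem warneMul_inverse_mul {G : Type*} [Group G] (θ : Monoid.End G) (u : ℤ → G)
    (x : ℤ × G × ℤ) : warneMul θ u (x.2.2, x.2.1⁻¹, x.1) x = (x.2.2, 1, x.2.2) := by
  simp [warneMul, warneF]

/-- The idempotents `(a, 1, a)` form a chain. -/
theorem warneMul_idempotent {G : Type*} [Group G] (θ : Monoid.End G) (u : ℤ → G) (a b : ℤ) :
    warneMul θ u (a, 1, a) (b, 1, b) = (max a b, 1, max a b) := by
  rcases le_or_gt b a with h | h
  · simp [warneMul, h]
  · simp [warneMul, h.not_ge, h.le]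

/-- An integer-valued function has clopen fibres as soon as its composite with
`a ↦ (a, 1, a)` is continuous. -/
theorem isClopen_fiber_of_continuous_idempotent {G X : Type*} [Group G] (θ : Monoid.End G)
    (u : ℤ → G) [TopologicalSpace X] [TopologicalSpace (ℤ × G × ℤ)] [T2Space (ℤ × G × ℤ)]
    (hm : Continuous fun p : (ℤ × G × ℤ) × (ℤ × G × ℤ) => warneMul θ u p.1 p.2)
    {k : X → ℤ} (hk : Continuous fun x => ((k x, 1, k x) : ℤ × G × ℤ)) (i : ℤ) :
    IsClopen {x | k x = i} := by
  have hmul (c : ℤ) : Continuous fun x => ((max (k x) c, 1, max (k x) c) : ℤ × G × ℤ) := by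
    simpa only [Function.comp_def, warneMul_idempotent] using
      hm.comp (hk.prodMk (continuous_const (y := ((c, 1, c) : ℤ × G × ℤ))))
  have hge (c : ℤ) : IsClosed {x | c ≤ k x} := by
    simpa using isClosed_eq (hmul c) hk
  have hle (c : ℤ) : IsClosed {x | k x ≤ c} := by
    simpa using isClosed_eq (hmul c) (continuous_const (y := ((c, 1, c) : ℤ × G × ℤ)))
  constructor
  · convert (hge i).inter (hle i) using 1
    ext x
    simp only [Set.mem_ofPred_eq, Set.mem_inter_iff]
    omega
  · convert (hge (i + 1)).isOpen_compl.inter (hle (i - 1)).isOpen_compl using 1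
    ext x
    simp only [Set.mem_ofPred_eq, Set.mem_inter_iff, Set.mem_compl_iff]
    omega

/-- If `t` is a Hausdorff topology on the Warne semigroup `B_W` with jointly
continuous multiplication and a `t`-continuous inversion, then every `H`-class
`G_{i,j} = {i} × G × {j}` is both open and closed in `(B_W, t)`. -/
theorem warne_H_classes_clopen {G : Type*} [Group G] (θ : Monoid.End G) (u : ℤ → G)
    (hu : ∀ n : ℤ, 1 ≤ n → u n = 1)
    (t : TopologicalSpace (ℤ × G × ℤ)) (ht2 : @T2Space _ t)
    (hm : @Continuous _ _ (@instTopologicalSpaceProd _ _ t t) t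
      (fun p : (ℤ × G × ℤ) × (ℤ × G × ℤ) => warneMul θ u p.1 p.2))
    (inv : ℤ × G × ℤ → ℤ × G × ℤ) (hinvc : @Continuous _ _ t t inv)
    (hinv : ∀ x : ℤ × G × ℤ, warneMul θ u (warneMul θ u x (inv x)) x = x ∧
      warneMul θ u (warneMul θ u (inv x) x) (inv x) = inv x) :
    ∀ i j : ℤ, t.IsOpen {p : ℤ × G × ℤ | p.1 = i ∧ p.2.2 = j} ∧
      @IsClosed _ t {p : ℤ × G × ℤ | p.1 = i ∧ p.2.2 = j} := by
  have hinv_eq (x) : inv x = (x.2.2, x.2.1⁻¹, x.1) :=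
    warneMul_inverse_eq (hinv x).1 (hinv x).2
  have hfst : Continuous fun x : ℤ × G × ℤ => ((x.1, 1, x.1) : ℤ × G × ℤ) := by
    simpa only [Function.comp_def, id, hinv_eq, warneMul_mul_inverse] using
      hm.comp (continuous_id.prodMk hinvc)
  have hsnd : Continuous fun x : ℤ × G × ℤ => ((x.2.2, 1, x.2.2) : ℤ × G × ℤ) := by
    simpa only [Function.comp_def, id, hinv_eq, warneMul_inverse_mul] using
      hm.comp (hinvc.prodMk continuous_id)
  intro i j
  have h := (isClopen_fiber_of_continuous_idempotent θ u hm hfst i).inter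
    (isClopen_fiber_of_continuous_idempotent θ u hm hsnd j)
  exact ⟨h.isOpen, h.isClosed⟩
end
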